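/- Let (f₁, D₁) and (f₂, D₂) be solutions of h'' = λ·h·m in integral form on an interval I with λ > 0, where f₁ is positive and nondecreasing, f₂ is positive and nonincreasing, and the (constant) Wronskian W := f₂(x) D₁(x) − f₁(x) D₂(x) is strictly positive. Fix z in the interior of I, set c := f₁(z)/f₂(z), and define h := f₁ − c f₂ and D_h := D₁ − c D₂. Then (h, D_h) is a solution of h'' = λ·h·m in integral form on I, h(z) = 0, and for every x ∈ I with x > z one has h(x) > 0 and D_h(x) ≥ W/f₂(z) > 0. -/

import Mathlib

open MeasureTheory Filter Set

/-- A pair `(f, D)` is a solution of `f'' = λ·f·m` in integral form on `S`: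
`f y − f x = ∫_x^y D(t) dt` and `D y − D x = λ ∫_{(x,y]} f dm` for all `x ≤ y` in `S`. -/
def IsIntegralSolution (m : MeasureTheory.Measure ℝ) (lam : ℝ) (S : Set ℝ)
    (f D : ℝ → ℝ) : Prop :=
  (∀ x ∈ S, ∀ y ∈ S, x ≤ y → f y - f x = ∫ t in x..y, D t) ∧
  (∀ x ∈ S, ∀ y ∈ S, x ≤ y → D y - D x = lam * ∫ t in Set.Ioc x y, f t ∂m)

namespace IsIntegralSolution

variable {m : Measure ℝ} {lam : ℝ} {S : Set ℝ} {f D : ℝ → ℝ}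

theorem monotoneOn_deriv (h : IsIntegralSolution m lam S f D) (hlam : 0 ≤ lam)
    (hS : S.OrdConnected) (hf : ∀ x ∈ S, 0 ≤ f x) : MonotoneOn D S := by
  intro x hx y hy hxy
  have hfint : 0 ≤ ∫ t in Ioc x y, f t ∂m :=
    setIntegral_nonneg measurableSet_Ioc fun t ht => hf t (hS.out hx hy (Ioc_subset_Icc_self ht))
  have := h.2 x hx y hy hxy
  linarith [mul_nonneg hlam hfint]

/-- If `D` takes the same value at `x` and `y`, then `m` does not charge `(x, y)`. -/
theorem measure_Ioo_eq_zero (h : IsIntegralSolution m lam S f D) (hlam : 0 < lam)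
    (hS : S.OrdConnected) (hm : ∀ K : Set ℝ, IsCompact K → K ⊆ interior S → m K < ⊤)
    (hpos : ∀ x ∈ S, 0 < f x)
    (hfint : ∀ x ∈ S, ∀ y ∈ S, m (Ioc x y) ≠ ⊤ → IntegrableOn f (Ioc x y) m)
    {x y : ℝ} (hx : x ∈ S) (hy : y ∈ S) (hD : D x = D y) : m (Ioo x y) = 0 := by
  have hmono := h.monotoneOn_deriv hlam.le hS fun t ht => (hpos t ht).le
  have hsub : Icc x y ⊆ S := hS.out hx hy
  have hconst : ∀ t ∈ Icc x y, D t = D x := fun t ht => le_antisymm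
    ((hmono (hsub ht) hy ht.2).trans hD.ge) (hmono hx (hsub ht) ht.1)
  have hnull : ∀ s ∈ Ioo x y, ∀ t ∈ Ioo x y, s ≤ t → m (Ioc s t) = 0 := by
    intro s hs t ht hst
    have hs' := Ioo_subset_Icc_self hs
    have ht' := Ioo_subset_Icc_self ht
    have hfin : m (Ioc s t) ≠ ⊤ := by
      refine ((measure_mono Ioc_subset_Icc_self).trans_lt (hm _ isCompact_Icc ?_)).ne
      exact (Icc_subset_Ioo hs.1 ht.2).trans
        (interior_maximal (Ioo_subset_Icc_self.trans hsub) isOpen_Ioo)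
    have hzero : ∫ u in Ioc s t, f u ∂m = 0 := by
      have := h.2 s (hsub hs') t (hsub ht') hst
      rw [hconst s hs', hconst t ht', sub_self, eq_comm, mul_eq_zero] at this
      exact this.resolve_left hlam.ne'
    have hfpos : ∀ u ∈ Ioc s t, 0 < f u := fun u hu =>
      hpos u (hS.out (hsub hs') (hsub ht') (Ioc_subset_Icc_self hu))
    by_contra hne
    refine (((setIntegral_pos_iff_support_of_nonneg_ae
      ((ae_restrict_mem measurableSet_Ioc).mono fun u hu => (hfpos u hu).le)
      (hfint s (hsub hs') t (hsub ht') hfin)).2 ?_).ne' hzero)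
    rw [inter_eq_right.2 (show Ioc s t ⊆ Function.support f from fun u hu => (hfpos u hu).ne')]
    exact pos_iff_ne_zero.2 hne
  rcases le_or_gt y x with hyx | hxy
  · simp [Ioo_eq_empty hyx.not_gt]
  obtain ⟨u, -, hu, hulim⟩ := exists_seq_strictAnti_tendsto' hxy
  obtain ⟨v, -, hv, hvlim⟩ := exists_seq_strictMono_tendsto' hxy
  refine measure_mono_null (t := ⋃ p : ℕ × ℕ, Ioc (u p.1) (v p.2)) ?_
    (measure_iUnion_null fun p => ?_)
  · intro t ht
    obtain ⟨i, hi⟩ := (hulim.eventually_lt_const ht.1).exists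
    obtain ⟨j, hj⟩ := (hvlim.eventually_const_lt ht.2).exists
    exact mem_iUnion.2 ⟨(i, j), hi, hj.le⟩
  · rcases le_total (u p.1) (v p.2) with hp | hp
    · exact hnull _ (hu _) _ (hv _) hp
    · simp [Ioc_eq_empty hp.not_gt]

/-- If `m` has infinite mass on `(x, y]`, then this mass sits on `{y}`, so that every Bochner
integral over `(x, y]` vanishes. -/
theorem setIntegral_Ioc_eq_zero (h : IsIntegralSolution m lam S f D) (hlam : 0 < lam)
    (hS : S.OrdConnected) (hm : ∀ K : Set ℝ, IsCompact K → K ⊆ interior S → m K < ⊤)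
    (hpos : ∀ x ∈ S, 0 < f x)
    (hfint : ∀ x ∈ S, ∀ y ∈ S, m (Ioc x y) ≠ ⊤ → IntegrableOn f (Ioc x y) m)
    {x y a : ℝ} (hx : x ∈ S) (hy : y ∈ S) (ha : 0 < a) (hbound : ∀ t ∈ Ioc x y, a ≤ f t)
    (htop : m (Ioc x y) = ⊤) (g : ℝ → ℝ) : ∫ t in Ioc x y, g t ∂m = 0 := by
  have hxy : x < y := by
    by_contra hle
    simp [Ioc_eq_empty hle] at htop
  have hD : D x = D y := by
    have hni : ¬ IntegrableOn f (Ioc x y) m := by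
      intro hi
      have hconst : IntegrableOn (fun _ => a) (Ioc x y) m := by
        refine Integrable.mono' hi aestronglyMeasurable_const
          ((ae_restrict_mem measurableSet_Ioc).mono fun t ht => ?_)
        simpa [abs_of_pos ha] using hbound t ht
      rcases (integrableOn_const_iff (by simp)).1 hconst with h0 | hlt
      · exact ha.ne' (by simpa using h0)
      · exact hlt.ne htop
    have := h.2 x hx y hy hxy.le
    rw [integral_undef hni, mul_zero] at this
    linarith
  have hIoo := h.measure_Ioo_eq_zero hlam hS hm hpos hfint hx hy hD
  have hae : Ioc x y =ᵐ[m] ({y} : Set ℝ) := by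
    rw [← Ioo_union_right hxy]
    simpa using union_ae_eq_right_of_ae_eq_empty (t := ({y} : Set ℝ)) (ae_eq_empty.2 hIoo)
  rw [setIntegral_congr_set hae, integral_singleton, Measure.real, ← measure_congr hae, htop]
  simp

end IsIntegralSolution

/-- A monotone function is integrable on `(x, y]` as soon as this set has finite mass. -/
theorem MonotoneOn.integrableOn_Ioc_of_measure_ne_top {m : Measure ℝ} {S : Set ℝ} {f : ℝ → ℝ}
    (hf : MonotoneOn f S) (hS : S.OrdConnected) {x y : ℝ} (hx : x ∈ S) (hy : y ∈ S)
    (hfin : m (Ioc x y) ≠ ⊤) : IntegrableOn f (Ioc x y) m := by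
  rcases le_or_gt x y with hxy | hyx
  · have hres : IntegrableOn f (Icc x y) (m.restrict (Ioc x y)) :=
      (hf.mono (hS.out hx hy)).integrableOn_of_measure_ne_top (isLeast_Icc hxy)
        (isGreatest_Icc hxy)
        (by rwa [Measure.restrict_apply measurableSet_Icc,
          inter_eq_right.2 Ioc_subset_Icc_self]) measurableSet_Icc
    rwa [IntegrableOn, Measure.restrict_restrict measurableSet_Icc,
      inter_eq_right.2 Ioc_subset_Icc_self] at hres
  · simp [Ioc_eq_empty hyx.not_gt]

/-- An antitone function is integrable on `(x, y]` as soon as this set has finite mass. -/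
theorem AntitoneOn.integrableOn_Ioc_of_measure_ne_top {m : Measure ℝ} {S : Set ℝ} {f : ℝ → ℝ}
    (hf : AntitoneOn f S) (hS : S.OrdConnected) {x y : ℝ} (hx : x ∈ S) (hy : y ∈ S)
    (hfin : m (Ioc x y) ≠ ⊤) : IntegrableOn f (Ioc x y) m := by
  simpa using (hf.neg.integrableOn_Ioc_of_measure_ne_top hS hx hy hfin).neg

/-- Construction of the positive increasing solution vanishing at `z`:
for solutions `(f₁, D₁)` (positive nondecreasing) and `(f₂, D₂)` (positive
nonincreasing) with constant Wronskian `W = f₂ D₁ − f₁ D₂ > 0`, the combination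
`h := f₁ − (f₁(z)/f₂(z)) f₂` is a solution in integral form, vanishes at `z`,
and for `x > z` in `I` satisfies `h(x) > 0` and `D_h(x) ≥ W / f₂(z) > 0`. -/
theorem integral_solution_vanishing_at_z
    (m : MeasureTheory.Measure ℝ) (lam : ℝ) (hlam : 0 < lam)
    (I : Set ℝ) (hI : I.OrdConnected)
    (hm : ∀ K : Set ℝ, IsCompact K → K ⊆ interior I → m K < ⊤)
    (f₁ D₁ f₂ D₂ : ℝ → ℝ)
    (h₁ : IsIntegralSolution m lam I f₁ D₁)
    (h₂ : IsIntegralSolution m lam I f₂ D₂)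
    (h₁pos : ∀ x ∈ I, 0 < f₁ x) (h₁mono : MonotoneOn f₁ I)
    (h₂pos : ∀ x ∈ I, 0 < f₂ x) (h₂anti : AntitoneOn f₂ I)
    (W : ℝ) (hWpos : 0 < W)
    (hW : ∀ x ∈ I, f₂ x * D₁ x - f₁ x * D₂ x = W)
    (z : ℝ) (hz : z ∈ interior I) :
    IsIntegralSolution m lam I
        (fun x => f₁ x - (f₁ z / f₂ z) * f₂ x)
        (fun x => D₁ x - (f₁ z / f₂ z) * D₂ x) ∧
      f₁ z - (f₁ z / f₂ z) * f₂ z = 0 ∧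
      ∀ x ∈ I, z < x →
        0 < f₁ x - (f₁ z / f₂ z) * f₂ x ∧
        W / f₂ z ≤ D₁ x - (f₁ z / f₂ z) * D₂ x ∧
        0 < W / f₂ z := by
  have hfz : 0 < f₂ z := h₂pos z (interior_subset hz)
  have hzI : z ∈ I := interior_subset hz
  set c := f₁ z / f₂ z with hc
  have hcpos : 0 < c := div_pos (h₁pos z hzI) hfz
  have hhz : f₁ z - c * f₂ z = 0 := by rw [hc]; field_simp; ring
  have hD₁ := h₁.monotoneOn_deriv hlam.le hI fun t ht => (h₁pos t ht).le
  have hD₂ := h₂.monotoneOn_deriv hlam.le hI fun t ht => (h₂pos t ht).le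
  have hDint : ∀ {D : ℝ → ℝ}, MonotoneOn D I → ∀ x ∈ I, ∀ y ∈ I,
      IntervalIntegrable D volume x y := fun hD x hx y hy =>
    (hD.mono (hI.uIcc_subset hx hy)).intervalIntegrable
  have hfint₁ : ∀ x ∈ I, ∀ y ∈ I, m (Ioc x y) ≠ ⊤ → IntegrableOn f₁ (Ioc x y) m :=
    fun x hx y hy => h₁mono.integrableOn_Ioc_of_measure_ne_top hI hx hy
  have hfint₂ : ∀ x ∈ I, ∀ y ∈ I, m (Ioc x y) ≠ ⊤ → IntegrableOn f₂ (Ioc x y) m :=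
    fun x hx y hy => h₂anti.integrableOn_Ioc_of_measure_ne_top hI hx hy
  have hsol : IsIntegralSolution m lam I (fun x => f₁ x - c * f₂ x)
      (fun x => D₁ x - c * D₂ x) := by
    refine ⟨fun x hx y hy hxy => ?_, fun x hx y hy hxy => ?_⟩
    · rw [intervalIntegral.integral_sub (hDint hD₁ x hx y hy)
        ((hDint hD₂ x hx y hy).const_mul c), intervalIntegral.integral_const_mul,
        ← h₁.1 x hx y hy hxy, ← h₂.1 x hx y hy hxy]
      ring
    · have e₁ := h₁.2 x hx y hy hxy
      have e₂ := h₂.2 x hx y hy hxy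
      by_cases htop : m (Ioc x y) = ⊤
      · have hzero := h₁.setIntegral_Ioc_eq_zero hlam hI hm h₁pos hfint₁ hx hy (h₁pos x hx)
          (fun t ht => h₁mono hx (hI.out hx hy (Ioc_subset_Icc_self ht)) ht.1.le) htop
        rw [hzero] at e₁ e₂ ⊢
        linear_combination e₁ - c * e₂
      · rw [integral_sub (hfint₁ x hx y hy htop) ((hfint₂ x hx y hy htop).const_mul c),
          integral_const_mul]
        linear_combination e₁ - c * e₂
  have hDz : D₁ z - c * D₂ z = W / f₂ z := by
    rw [hc, ← hW z hzI]
    field_simp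
  have hDge : ∀ x ∈ I, z ≤ x → W / f₂ z ≤ D₁ x - c * D₂ x := by
    intro x hx hzx
    have hnonneg : 0 ≤ ∫ t in Ioc z x, (f₁ t - c * f₂ t) ∂m := by
      refine setIntegral_nonneg measurableSet_Ioc fun t ht => ?_
      have htI : t ∈ I := hI.out hzI hx (Ioc_subset_Icc_self ht)
      have := mul_le_mul_of_nonneg_left (h₂anti hzI htI ht.1.le) hcpos.le
      linarith [h₁mono hzI htI ht.1.le]
    have := hsol.2 z hzI x hx hzx
    linarith [mul_nonneg hlam.le hnonneg]
  refine ⟨hsol, hhz, fun x hx hzx => ⟨?_, hDge x hx hzx.le, div_pos hWpos hfz⟩⟩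
  have hle : ∫ _ in z..x, W / f₂ z ≤ ∫ t in z..x, (D₁ t - c * D₂ t) :=
    intervalIntegral.integral_mono_on hzx.le intervalIntegrable_const
      ((hDint hD₁ z hzI x hx).sub ((hDint hD₂ z hzI x hx).const_mul c))
      fun t ht => hDge t (hI.out hzI hx ht) ht.1
  have heq := hsol.1 z hzI x hx hzx.le
  rw [intervalIntegral.integral_const, smul_eq_mul] at hle
  linarith [mul_pos (sub_pos.2 hzx) (div_pos hWpos hfz)]
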